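/- Let r ∈ (0,1) and let C₆, C₇ > 0. There is a constant K > 0, depending only on r, with the following property: for every δ > 0 and every C² function v : Δ_r → ℝ satisfying v(ζ) ≤ C₆ δ and |Δv(ζ)| ≤ C₇ δ for all ζ ∈ Δ_r, and v(0) ≥ −δ, one has |∇v(0)| ≤ K (C₆ + C₇ + 1) δ. (This is proved by subtracting the Newtonian potential (1/2π) ln|ζ| * Δv of Δv, obtaining a negative harmonic function g on Δ_r with |g(0)| controlled by (C₆ + C₇ + 1)δ, and applying the Schwarz lemma for negative harmonic functions |∇g(0)| ≤ 2|g(0)|/dist(0,∂Δ_r).) -/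

import Mathlib

open Metric Set

noncomputable section

/-- The Laplacian of a real valued function on (an open subset of) `ℂ`. -/
noncomputable def lap (f : ℂ → ℝ) (ζ : ℂ) : ℝ :=
  fderiv ℝ (fun z => fderiv ℝ f z 1) ζ 1 +
    fderiv ℝ (fun z => fderiv ℝ f z Complex.I) ζ Complex.I

lemma aux_param (G G' : ℝ → ℝ → ℝ) (hG : Continuous (fun p : ℝ × ℝ => G p.1 p.2))
    (hG' : Continuous (fun p : ℝ × ℝ => G' p.1 p.2))
    (hd : ∀ x t, HasDerivAt (fun x => G x t) (G' x t) x) (x : ℝ) :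
    HasDerivAt (fun x => ∫ t in (0:ℝ)..(2 * Real.pi), G x t)
      (∫ t in (0:ℝ)..(2 * Real.pi), G' x t) x := by
  have hc : ∀ y, Continuous (G y) := fun y => hG.comp (by fun_prop : Continuous fun t : ℝ => (y, t))
  have hc' : ∀ y, Continuous (G' y) :=
    fun y => hG'.comp (by fun_prop : Continuous fun t : ℝ => (y, t))
  obtain ⟨B, hB⟩ := ((isCompact_closedBall x 1).prod
    (isCompact_uIcc (a := (0:ℝ)) (b := 2 * Real.pi))).exists_bound_of_continuousOn hG'.continuousOn
  refine (intervalIntegral.hasDerivAt_integral_of_dominated_loc_of_deriv_le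
    (bound := fun _ => B) (Metric.closedBall_mem_nhds x one_pos)
    (Filter.Eventually.of_forall fun y => (hc y).aestronglyMeasurable)
    ((hc x).intervalIntegrable _ _) (hc' x).aestronglyMeasurable
    (Filter.Eventually.of_forall fun t ht y hy => ?_)
    intervalIntegrable_const
    (Filter.Eventually.of_forall fun t _ y _ => hd y t)).2
  exact hB (y, t) ⟨hy, uIoc_subset_uIcc ht⟩

/-- unit vector -/
def ee (θ : ℝ) : ℂ := Complex.exp (θ * Complex.I)

lemma ee_cont : Continuous ee := by unfold ee; fun_prop

lemma ee_deriv (θ : ℝ) : HasDerivAt ee (Complex.I * ee θ) θ := by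
  have h : HasDerivAt (fun z : ℂ => Complex.exp (z * Complex.I))
      (Complex.exp (θ * Complex.I) * (1 * Complex.I)) (θ : ℂ) :=
    ((hasDerivAt_id _).mul_const _).cexp
  have := h.comp_ofReal
  unfold ee
  convert this using 1
  ring

lemma ee_norm (θ : ℝ) : ‖ee θ‖ = 1 := Complex.norm_exp_ofReal_mul_I θ

lemma ee_eq (θ : ℝ) : ee θ = Real.cos θ • (1:ℂ) + Real.sin θ • Complex.I := by
  unfold ee
  rw [Complex.exp_mul_I]; simp

lemma iee_eq (θ : ℝ) : Complex.I * ee θ = (-Real.sin θ) • (1:ℂ) + Real.cos θ • Complex.I := by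
  rw [ee_eq, mul_add]
  apply Complex.ext <;> simp

lemma lap_eq (w : ℂ → ℝ) (hw : ContDiff ℝ 2 w) (z : ℂ) (θ : ℝ) :
    lap w z = fderiv ℝ (fderiv ℝ w) z (ee θ) (ee θ)
      + fderiv ℝ (fderiv ℝ w) z (Complex.I * ee θ) (Complex.I * ee θ) := by
  have hD : DifferentiableAt ℝ (fderiv ℝ w) z :=
    ((hw.fderiv_right (m := 1) (by norm_num)).differentiable (by norm_num)) z
  have h (u : ℂ) : fderiv ℝ (fun z => fderiv ℝ w z u) z u = fderiv ℝ (fderiv ℝ w) z u u := by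
    rw [fderiv_clm_apply hD (by fun_prop)]
    simp
  unfold lap
  rw [h, h, iee_eq, ee_eq]
  simp only [map_add, map_smul, ContinuousLinearMap.add_apply, ContinuousLinearMap.smul_apply,
    smul_eq_mul]
  linear_combination (-(fderiv ℝ (fderiv ℝ w) z 1 1 +
    fderiv ℝ (fderiv ℝ w) z Complex.I Complex.I)) * Real.sin_sq_add_cos_sq θ

lemma core (w : ℂ → ℝ) (hw : ContDiff ℝ 2 w) (c c' : ℝ → ℝ) (k : ℝ)
    (hc : ∀ t, HasDerivAt c (c' t) t) (hc' : ∀ t, HasDerivAt c' (-k * c t) t)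
    (hp : c (2 * Real.pi) = c 0) (hp' : c' (2 * Real.pi) = c' 0) :
    ∃ q : ℝ → ℝ, ∀ ρ : ℝ,
      HasDerivAt (fun ρ : ℝ => ∫ t in (0:ℝ)..(2 * Real.pi), w (ρ • ee t) * c t)
        (∫ t in (0:ℝ)..(2 * Real.pi), fderiv ℝ w (ρ • ee t) (ee t) * c t) ρ ∧
      HasDerivAt (fun ρ : ℝ => ∫ t in (0:ℝ)..(2 * Real.pi), fderiv ℝ w (ρ • ee t) (ee t) * c t)
        (q ρ) ρ ∧
      ρ ^ 2 * q ρ + ρ * (∫ t in (0:ℝ)..(2 * Real.pi), fderiv ℝ w (ρ • ee t) (ee t) * c t)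
        - k * (∫ t in (0:ℝ)..(2 * Real.pi), w (ρ • ee t) * c t)
        = ρ ^ 2 * ∫ t in (0:ℝ)..(2 * Real.pi), lap w (ρ • ee t) * c t := by
  have hcc : Continuous c := continuous_iff_continuousAt.2 fun t => (hc t).continuousAt
  have hcc' : Continuous c' := continuous_iff_continuousAt.2 fun t => (hc' t).continuousAt
  have he := ee_cont
  have h1 : ContDiff ℝ 1 (fderiv ℝ w) := hw.fderiv_right (m := 1) (by norm_num)
  have hwc : Continuous w := hw.continuous
  have hDc : Continuous (fderiv ℝ w) := h1.continuous
  have hHc : Continuous (fderiv ℝ (fderiv ℝ w)) := h1.continuous_fderiv (by norm_num)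
  have hwd : ∀ z, HasFDerivAt w (fderiv ℝ w z) z :=
    fun z => (hw.differentiable (by norm_num) z).hasFDerivAt
  have hDd : ∀ z, HasFDerivAt (fderiv ℝ w) (fderiv ℝ (fderiv ℝ w) z) z :=
    fun z => (h1.differentiable (by norm_num) z).hasFDerivAt
  have hr : ∀ (t x : ℝ), HasDerivAt (fun x : ℝ => x • ee t) (ee t) x := fun t x => by
    simpa using (hasDerivAt_id x).smul_const (ee t)
  have ht : ∀ (x t : ℝ), HasDerivAt (fun t : ℝ => x • ee t) (x • (Complex.I * ee t)) t :=
    fun x t => (ee_deriv t).const_smul x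
  refine ⟨fun ρ => ∫ t in (0:ℝ)..(2 * Real.pi),
    fderiv ℝ (fderiv ℝ w) (ρ • ee t) (ee t) (ee t) * c t, fun ρ => ⟨?_, ?_, ?_⟩⟩
  · refine aux_param (fun x t => w (x • ee t) * c t)
      (fun x t => fderiv ℝ w (x • ee t) (ee t) * c t) (by fun_prop) (by fun_prop)
      (fun x t => ?_) ρ
    exact ((hwd _).comp_hasDerivAt x (hr t x)).mul_const _
  · refine aux_param (fun x t => fderiv ℝ w (x • ee t) (ee t) * c t)
      (fun x t => fderiv ℝ (fderiv ℝ w) (x • ee t) (ee t) (ee t) * c t)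
      (by fun_prop) (by fun_prop) (fun x t => ?_) ρ
    have := (((hDd _).comp_hasDerivAt x (hr t x)).clm_apply (hasDerivAt_const x (ee t)))
    simpa using this.mul_const (c t)
  · have e0 : ee (2 * Real.pi) = ee 0 := by
      unfold ee; simp
    -- total derivative in θ
    let Φ : ℝ → ℝ := fun t => ρ * (fderiv ℝ w (ρ • ee t) (Complex.I * ee t)) * c t
      - w (ρ • ee t) * c' t
    have hΦ : ∀ t, HasDerivAt Φ (ρ ^ 2 * (fderiv ℝ (fderiv ℝ w) (ρ • ee t)
        (Complex.I * ee t) (Complex.I * ee t) * c t) - ρ * (fderiv ℝ w (ρ • ee t) (ee t) * c t)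
        + k * (w (ρ • ee t) * c t)) t := by
      intro t
      have a1 := ((hDd _).comp_hasDerivAt t (ht ρ t)).clm_apply ((ee_deriv t).const_mul Complex.I)
      have a2 := (hwd _).comp_hasDerivAt t (ht ρ t)
      have a3 := ((a1.const_mul ρ).mul (hc t)).sub (a2.mul (hc' t))
      have hI : Complex.I * (Complex.I * ee t) = - ee t := by
        rw [← mul_assoc, Complex.I_mul_I]; simp
      refine a3.congr_deriv ?_
      simp only [Function.comp, hI, map_neg, map_smul, ContinuousLinearMap.smul_apply, smul_eq_mul]
      ring
    have hint := intervalIntegral.integral_eq_sub_of_hasDerivAt (a := 0) (b := 2 * Real.pi)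
      (fun t _ => hΦ t) (Continuous.intervalIntegrable (by fun_prop) _ _)
    have hz : Φ (2 * Real.pi) - Φ 0 = 0 := by
      simp only [Φ, e0, hp, hp', sub_self]
    rw [hz, intervalIntegral.integral_add, intervalIntegral.integral_sub,
      intervalIntegral.integral_const_mul, intervalIntegral.integral_const_mul,
      intervalIntegral.integral_const_mul] at hint
    rotate_left
    all_goals try exact Continuous.intervalIntegrable (by fun_prop) _ _
    have hl : (∫ t in (0:ℝ)..(2 * Real.pi), lap w (ρ • ee t) * c t)
        = (∫ t in (0:ℝ)..(2 * Real.pi),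
            fderiv ℝ (fderiv ℝ w) (ρ • ee t) (ee t) (ee t) * c t)
          + ∫ t in (0:ℝ)..(2 * Real.pi), fderiv ℝ (fderiv ℝ w) (ρ • ee t)
            (Complex.I * ee t) (Complex.I * ee t) * c t := by
      rw [← intervalIntegral.integral_add]
      · refine intervalIntegral.integral_congr fun t _ => ?_
        simp only [lap_eq w hw _ t]; ring
      all_goals exact Continuous.intervalIntegrable (by fun_prop) _ _
    rw [hl]
    linear_combination -hint

lemma ode0 (A p q F : ℝ → ℝ) (N R : ℝ) (hR : 0 < R)
    (hA : ∀ x, HasDerivAt A (p x) x) (hp : ∀ x, HasDerivAt p (q x) x)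
    (heq : ∀ x, x ^ 2 * q x + x * p x = x ^ 2 * F x) (hp0 : p 0 = 0)
    (hF : ∀ x ∈ Icc 0 R, |F x| ≤ N) : |A R - A 0| ≤ N * R ^ 2 := by
  have hN : 0 ≤ N := (abs_nonneg _).trans (hF 0 ⟨le_rfl, hR.le⟩)
  have hQ : ∀ x, HasDerivAt (fun x => x * p x) (x * F x) x := by
    intro x
    refine ((hasDerivAt_id x).mul (hp x)).congr_deriv ?_
    by_cases hx : x = 0
    · subst hx; simp [hp0]
    · apply mul_left_cancel₀ hx
      simp only [id]
      linear_combination heq x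
  have hpb : ∀ x ∈ Icc 0 R, |p x| ≤ N * R := by
    intro x hx
    rcases hx.1.eq_or_lt with h | h
    · rw [← h, hp0, abs_zero]; positivity
    · have := norm_image_sub_le_of_norm_deriv_le_segment' (a := 0) (b := x) (C := x * N)
        (fun y _ => (hQ y).hasDerivWithinAt) (fun y hy => by
          rw [Real.norm_eq_abs, abs_mul, abs_of_nonneg hy.1]
          exact mul_le_mul hy.2.le (hF y ⟨hy.1, hy.2.le.trans hx.2⟩) (abs_nonneg _) h.le)
          x ⟨h.le, le_rfl⟩
      simp only [zero_mul, sub_zero, Real.norm_eq_abs, abs_mul, abs_of_pos h] at this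
      have h2 : |p x| ≤ N * x := by
        apply le_of_mul_le_mul_left _ h
        linarith
      exact h2.trans (mul_le_mul_of_nonneg_left hx.2 hN)
  have := norm_image_sub_le_of_norm_deriv_le_segment' (a := 0) (b := R) (C := N * R)
    (fun y _ => (hA y).hasDerivWithinAt) (fun y hy => hpb y ⟨hy.1, hy.2.le⟩) R ⟨hR.le, le_rfl⟩
  rw [Real.norm_eq_abs] at this
  linarith

lemma ode1 (A p q F : ℝ → ℝ) (N R : ℝ) (hR : 0 < R)
    (hA : ∀ x, HasDerivAt A (p x) x) (hp : ∀ x, HasDerivAt p (q x) x)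
    (heq : ∀ x, x ^ 2 * q x + x * p x - 1 * A x = x ^ 2 * F x) 
    (hF : ∀ x ∈ Icc 0 R, |F x| ≤ N) : |p 0| ≤ |A R| / R + N * R := by
  have hN : 0 ≤ N := (abs_nonneg _).trans (hF 0 ⟨le_rfl, hR.le⟩)
  have hA0 : A 0 = 0 := by simpa using heq 0
  have hQ : ∀ x, HasDerivAt (fun x => x ^ 2 * p x - x * A x) (x ^ 2 * F x) x := by
    intro x
    refine (((hasDerivAt_pow 2 x).mul (hp x)).sub ((hasDerivAt_id x).mul (hA x))).congr_deriv ?_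
    simp only [id]
    push_cast
    linear_combination heq x
  have hQb : ∀ x ∈ Icc 0 R, |x ^ 2 * p x - x * A x| ≤ N * x ^ 3 := by
    intro x hx
    have := norm_image_sub_le_of_norm_deriv_le_segment' (a := 0) (b := x) (C := x ^ 2 * N)
        (fun y _ => (hQ y).hasDerivWithinAt) (fun y hy => by
          rw [Real.norm_eq_abs, abs_mul, abs_of_nonneg (sq_nonneg y)]
          have := hy.1
          exact mul_le_mul (by gcongr; exact hy.2.le) (hF y ⟨hy.1, hy.2.le.trans hx.2⟩)
            (abs_nonneg _) (sq_nonneg x))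
          x ⟨hx.1, le_rfl⟩
    rw [Real.norm_eq_abs] at this
    norm_num at this
    linarith
  have hkey : ∀ ε ∈ Ioo 0 R, |A ε / ε| ≤ |A R| / R + N * R := by
    intro ε hε
    have hd : ∀ y ∈ Icc ε R, HasDerivAt (fun x => A x / x) ((p y * y - A y * 1) / y ^ 2) y :=
      fun y hy => (hA y).div (hasDerivAt_id y) (hε.1.trans_le hy.1).ne'
    have := norm_image_sub_le_of_norm_deriv_le_segment' (a := ε) (b := R) (C := N)
        (fun y hy => (hd y hy).hasDerivWithinAt) (fun y hy => by
          have hy0 : 0 < y := hε.1.trans_le hy.1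
          have h3 := hQb y ⟨hy0.le, hy.2.le⟩
          have : y ^ 2 * p y - y * A y = y * (p y * y - A y * 1) := by ring
          rw [this, abs_mul, abs_of_pos hy0] at h3
          rw [Real.norm_eq_abs, abs_div, abs_of_pos (pow_pos hy0 2), div_le_iff₀ (pow_pos hy0 2)]
          apply le_of_mul_le_mul_left _ hy0
          linarith) R ⟨hε.2.le, le_rfl⟩
    rw [Real.norm_eq_abs, abs_sub_comm] at this
    have h4 := abs_sub_abs_le_abs_sub (A ε / ε) (A R / R)
    rw [abs_div (A R), abs_of_pos hR] at h4
    have : N * (R - ε) ≤ N * R := mul_le_mul_of_nonneg_left (by linarith [hε.1]) hN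
    linarith
  have hlim : Filter.Tendsto (fun ε => |A ε / ε|) (nhdsWithin 0 (Ioi 0)) (nhds |p 0|) := by
    have := (hasDerivAt_iff_tendsto_slope_zero.1 (hA 0)).mono_left
      (nhdsWithin_mono (0:ℝ) (t := {0}ᶜ) (s := Ioi 0) (fun x (hx : 0 < x) => ne_of_gt hx))
    refine (this.congr fun x => ?_).abs
    simp [hA0, div_eq_inv_mul]
  refine le_of_tendsto hlim ?_
  filter_upwards [Ioo_mem_nhdsGT hR] with ε hε using hkey ε hε

lemma weight_bound (w : ℂ → ℝ) (hw : ContDiff ℝ 2 w) (c : ℝ → ℝ)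
    (hc1 : ∀ t, |c t| ≤ 1) (R N : ℝ)
    (hl : ∀ z ∈ Metric.closedBall (0:ℂ) R, |lap w z| ≤ N) :
    ∀ ρ ∈ Icc 0 R, |∫ t in (0:ℝ)..(2 * Real.pi), lap w (ρ • ee t) * c t| ≤ 2 * Real.pi * N := by
  intro ρ hρ
  have := intervalIntegral.norm_integral_le_of_norm_le_const (a := 0) (b := 2 * Real.pi) (C := N)
    (f := fun t => lap w (ρ • ee t) * c t) (fun t _ => by
      have h1 := hl (ρ • ee t) (by simp [norm_smul, ee_norm, abs_of_nonneg hρ.1, hρ.2])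
      rw [Real.norm_eq_abs, abs_mul]
      calc _ ≤ N * 1 := mul_le_mul h1 (hc1 t) (abs_nonneg _) ((abs_nonneg _).trans h1)
        _ = N := mul_one N)
  rw [Real.norm_eq_abs, sub_zero, abs_of_pos Real.two_pi_pos] at this
  linarith

lemma global_bound (w : ℂ → ℝ) (hw : ContDiff ℝ 2 w) (R a b δ : ℝ) (hR : 0 < R) (hR1 : R < 1)
    (ha : 0 < a) (hb : 0 < b)
    (hu : ∀ z ∈ Metric.closedBall (0:ℂ) R, w z ≤ a)
    (hl : ∀ z ∈ Metric.closedBall (0:ℂ) R, |lap w z| ≤ b) (h0 : -δ ≤ w 0) (hδ : 0 < δ) :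
    ‖fderiv ℝ w 0‖ ≤ 8 / R * (a + b + δ) := by
  have hpi := Real.pi_pos
  have he := ee_cont
  have hwc := hw.continuous
  set L := fderiv ℝ w 0 with hL
  have hLe : ∀ t, L (ee t) = Real.cos t * L 1 + Real.sin t * L Complex.I := by
    intro t; rw [ee_eq, map_add, map_smul, map_smul, smul_eq_mul, smul_eq_mul]
  obtain ⟨q0, hq0⟩ := core w hw (fun _ => 1) (fun _ => 0) 0
    (fun t => hasDerivAt_const t 1) (fun t => by simpa using hasDerivAt_const t (0:ℝ)) rfl rfl
  have hM := ode0 _ _ q0 _ (2 * Real.pi * b) R hR (fun x => (hq0 x).1) (fun x => (hq0 x).2.1)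
    (fun x => by have := (hq0 x).2.2; rw [zero_mul, sub_zero] at this; exact this)
    (by
      simp only [zero_smul, ← hL, hLe, mul_one]
      rw [intervalIntegral.integral_add (Continuous.intervalIntegrable (by fun_prop) _ _)
        (Continuous.intervalIntegrable (by fun_prop) _ _)]
      simp)
    (weight_bound w hw _ (by simp) R b hl)
  simp only [mul_one, zero_smul, intervalIntegral.integral_const, sub_zero, smul_eq_mul] at hM
  have hR2 : R ^ 2 ≤ 1 := by nlinarith
  have hMl : -(2 * Real.pi * δ) - 2 * Real.pi * b ≤ ∫ t in (0:ℝ)..(2 * Real.pi), w (R • ee t) := by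
    have h1 := (abs_le.1 hM).1
    have h2 : 2 * Real.pi * (-δ) ≤ 2 * Real.pi * w 0 := by gcongr
    have h3 : 2 * Real.pi * b * R ^ 2 ≤ 2 * Real.pi * b * 1 := by gcongr
    linarith
  have hAb : ∀ c : ℝ → ℝ, Continuous c → (∀ t, |c t| ≤ 1) →
      |∫ t in (0:ℝ)..(2 * Real.pi), w (R • ee t) * c t| ≤ Real.pi * (4 * a + 2 * b + 2 * δ) := by
    intro c hc hc1
    have h1 : ‖∫ t in (0:ℝ)..(2 * Real.pi), w (R • ee t) * c t‖ ≤
        ∫ t in (0:ℝ)..(2 * Real.pi), (2 * a - w (R • ee t)) := by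
      refine intervalIntegral.norm_integral_le_of_norm_le (by positivity)
        (Filter.Eventually.of_forall fun t _ => ?_) 
        (Continuous.intervalIntegrable (by fun_prop) _ _)
      have h1 := hu (R • ee t) (by simp [norm_smul, ee_norm, abs_of_pos hR])
      rw [Real.norm_eq_abs, abs_mul]
      calc _ ≤ |w (R • ee t)| * 1 := mul_le_mul_of_nonneg_left (hc1 t) (abs_nonneg _)
        _ ≤ _ := by rw [mul_one, abs_le]; constructor <;> linarith
    rw [intervalIntegral.integral_sub (Continuous.intervalIntegrable (by fun_prop) _ _)
        (Continuous.intervalIntegrable (by fun_prop) _ _), Real.norm_eq_abs] at h1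
    simp only [intervalIntegral.integral_const, sub_zero, smul_eq_mul] at h1
    linarith
  have hfin : ∀ y A : ℝ, |A| ≤ Real.pi * (4 * a + 2 * b + 2 * δ) →
      |Real.pi * y| ≤ |A| / R + 2 * Real.pi * b * R → |y| ≤ 4 / R * (a + b + δ) := by
    intro y A h1 h2
    rw [abs_mul, abs_of_pos hpi] at h2
    have h3 : |A| / R ≤ Real.pi * (4 * a + 2 * b + 2 * δ) / R := by gcongr
    have h4 : 2 * Real.pi * b * R ≤ 2 * Real.pi * b / R := by
      rw [le_div_iff₀ hR]
      have : 2 * Real.pi * b * R ^ 2 ≤ 2 * Real.pi * b * 1 := by gcongr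
      linarith
    have h5 : Real.pi * |y| ≤ Real.pi * ((4 * a + 4 * b + 4 * δ) / R) := by
      have h6 : Real.pi * (4 * a + 2 * b + 2 * δ) / R + 2 * Real.pi * b / R 
        ≤ Real.pi * ((4 * a + 4 * b + 4 * δ) / R) := by
        rw [← add_div, ← mul_div_assoc]
        gcongr
        nlinarith
      linarith
    have := le_of_mul_le_mul_left h5 hpi
    calc _ ≤ _ := this
      _ = _ := by ring
  have b1 : |L 1| ≤ 4 / R * (a + b + δ) := by
    obtain ⟨q, hq⟩ := core w hw Real.cos (fun t => -Real.sin t) 1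
      Real.hasDerivAt_cos (fun t => by rw [neg_one_mul]; exact (Real.hasDerivAt_sin t).neg) (by simp) (by simp)
    have := ode1 _ _ q _ (2 * Real.pi * b) R hR (fun x => (hq x).1) (fun x => (hq x).2.1)
      (fun x => (hq x).2.2) (weight_bound w hw _ Real.abs_cos_le_one R b hl)
    refine hfin _ _ (hAb _ Real.continuous_cos Real.abs_cos_le_one) (le_of_eq_of_le ?_ this)
    simp only [zero_smul, ← hL, hLe]
    congr 1
    have : ∀ t, (Real.cos t * L 1 + Real.sin t * L Complex.I) * Real.cos t
      = L 1 * Real.cos t ^ 2 + L Complex.I * (Real.sin t * Real.cos t) := fun t => by ring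
    simp only [this]
    rw [intervalIntegral.integral_add (Continuous.intervalIntegrable (by fun_prop) _ _)
        (Continuous.intervalIntegrable (by fun_prop) _ _), intervalIntegral.integral_const_mul,
        intervalIntegral.integral_const_mul, integral_cos_sq, integral_sin_mul_cos₁]
    simp
    ring
  have b2 : |L Complex.I| ≤ 4 / R * (a + b + δ) := by
    obtain ⟨q, hq⟩ := core w hw Real.sin Real.cos 1
      Real.hasDerivAt_sin (fun t => by simpa using Real.hasDerivAt_cos t) (by simp) (by simp)
    have := ode1 _ _ q _ (2 * Real.pi * b) R hR (fun x => (hq x).1) (fun x => (hq x).2.1)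
      (fun x => (hq x).2.2) (weight_bound w hw _ Real.abs_sin_le_one R b hl)
    refine hfin _ _ (hAb _ Real.continuous_sin Real.abs_sin_le_one) (le_of_eq_of_le ?_ this)
    simp only [zero_smul, ← hL, hLe]
    congr 1
    have : ∀ t, (Real.cos t * L 1 + Real.sin t * L Complex.I) * Real.sin t
      = L Complex.I * Real.sin t ^ 2 + L 1 * (Real.sin t * Real.cos t) := fun t => by ring
    simp only [this]
    rw [intervalIntegral.integral_add (Continuous.intervalIntegrable (by fun_prop) _ _)
        (Continuous.intervalIntegrable (by fun_prop) _ _), intervalIntegral.integral_const_mul,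
        intervalIntegral.integral_const_mul, integral_sin_sq, integral_sin_mul_cos₁]
    simp
    ring
  refine L.opNorm_le_bound (by positivity) fun z => ?_
  have hz : z = z.re • (1:ℂ) + z.im • Complex.I := by apply Complex.ext <;> simp
  have h1 : L z = z.re * L 1 + z.im * L Complex.I := by
    conv_lhs => rw [hz]
    rw [map_add, map_smul, map_smul, smul_eq_mul, smul_eq_mul]
  rw [h1, Real.norm_eq_abs]
  calc _ ≤ |z.re * L 1| + |z.im * L Complex.I| := abs_add_le _ _
    _ = |z.re| * |L 1| + |z.im| * |L Complex.I| := by rw [abs_mul, abs_mul]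
    _ ≤ ‖z‖ * (4 / R * (a + b + δ)) + ‖z‖ * (4 / R * (a + b + δ)) := by
      gcongr
      · exact Complex.abs_re_le_norm z
      · exact Complex.abs_im_le_norm z
    _ = _ := by ring

lemma extend (r : ℝ) (hr : 0 < r) (v : ℂ → ℝ) (hv : ContDiffOn ℝ 2 v (Metric.ball 0 r)) :
    ∃ w : ℂ → ℝ, ContDiff ℝ 2 w ∧ ∀ z ∈ Metric.ball (0:ℂ) (r / 3), w z = v z := by
  let χ : ContDiffBump (0:ℂ) := ⟨r / 3, r / 2, by positivity, by linarith⟩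
  refine ⟨fun z => χ z * v z, ?_, fun z hz => ?_⟩
  · rw [contDiff_iff_contDiffAt]
    intro z
    by_cases hz : z ∈ Metric.ball (0:ℂ) r
    · exact χ.contDiff.contDiffAt.mul (hv.contDiffAt (Metric.isOpen_ball.mem_nhds hz))
    · have : z ∉ tsupport χ := by
        rw [χ.tsupport_eq]
        intro h
        apply hz
        have h' : dist z 0 ≤ r / 2 := h
        exact lt_of_le_of_lt h' (by linarith)
      have h0 : (fun z => χ z * v z) =ᶠ[nhds z] fun _ => 0 := by
        filter_upwards [notMem_tsupport_iff_eventuallyEq.1 this] with y hy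
        simp [hy]
      exact contDiffAt_const.congr_of_eventuallyEq h0
  · beta_reduce
    rw [χ.one_of_mem_closedBall (Metric.ball_subset_closedBall hz), one_mul]

/-- Schwarz-type gradient estimate at the center for `C²` functions on `Δ_r`
bounded above by `C₆ δ`, with Laplacian bounded by `C₇ δ`, and value at `0` at least `-δ`.
The constant `K` depends only on `r`. -/
theorem gradient_bound_from_laplacian_control
    (r : ℝ) (hr0 : 0 < r) (hr1 : r < 1) :
    ∃ K : ℝ, 0 < K ∧
      ∀ C₆ C₇ : ℝ, 0 < C₆ → 0 < C₇ → ∀ δ : ℝ, 0 < δ →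
        ∀ v : ℂ → ℝ, ContDiffOn ℝ 2 v (Metric.ball 0 r) →
          (∀ ζ ∈ Metric.ball (0:ℂ) r, v ζ ≤ C₆ * δ ∧ |lap v ζ| ≤ C₇ * δ) →
          -δ ≤ v 0 →
          ‖fderiv ℝ v 0‖ ≤ K * (C₆ + C₇ + 1) * δ := by
  refine ⟨32 / r, by positivity, fun C₆ C₇ h6 h7 δ hδ v hv hb h0 => ?_⟩
  obtain ⟨w, hw, hwv⟩ := extend r hr0 v hv
  have hev : ∀ z ∈ Metric.ball (0:ℂ) (r / 3), w =ᶠ[nhds z] v := fun z hz => by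
    filter_upwards [Metric.isOpen_ball.mem_nhds hz] with y hy using hwv y hy
  have hfd : ∀ z ∈ Metric.ball (0:ℂ) (r / 3), fderiv ℝ w z = fderiv ℝ v z :=
    fun z hz => (hev z hz).fderiv_eq
  have hlap : ∀ z ∈ Metric.ball (0:ℂ) (r / 3), lap w z = lap v z := by
    intro z hz
    have h : ∀ u : ℂ, fderiv ℝ (fun z => fderiv ℝ w z u) z = fderiv ℝ (fun z => fderiv ℝ v z u) z :=
      fun u => Filter.EventuallyEq.fderiv_eq (by
        filter_upwards [Metric.isOpen_ball.mem_nhds hz] with y hy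
        rw [hfd y hy])
    unfold lap
    rw [h, h]
  have hs1 : Metric.closedBall (0:ℂ) (r / 4) ⊆ Metric.ball 0 (r / 3) :=
    Metric.closedBall_subset_ball (by linarith)
  have hs2 : Metric.ball (0:ℂ) (r / 3) ⊆ Metric.ball 0 r := Metric.ball_subset_ball (by linarith)
  have hz0 : (0:ℂ) ∈ Metric.ball (0:ℂ) (r / 3) := Metric.mem_ball_self (by positivity)
  have := global_bound w hw (r / 4) (C₆ * δ) (C₇ * δ) δ (by positivity) (by linarith)
    (by positivity) (by positivity)
    (fun z hz => by rw [hwv z (hs1 hz)]; exact (hb z (hs2 (hs1 hz))).1)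
    (fun z hz => by rw [hlap z (hs1 hz)]; exact (hb z (hs2 (hs1 hz))).2)
    (by rw [hwv 0 hz0]; exact h0) hδ
  rw [hfd 0 hz0] at this
  refine this.trans (le_of_eq ?_)
  field_simp
  ring

end
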